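/- With X as in the tangent-normal decomposition with d ≥ 2 and E ξ² > 1/d, the second moment of ξ is recovered from the distribution of X via E ξ² = 1/d + √((d−1)/d) · √(E[Xᵀ E[XXᵀ] X] − 1/d), and μμᵀ = √((d−1)/(d·E[Xᵀ E[XXᵀ] X] − 1)) · (E[XXᵀ] − (1/d)I_d) + (1/d)I_d. -/

import Mathlib

open MeasureTheory Real
open scoped RealInnerProductSpace ENNReal

/-- The uniform distribution on the unit sphere of the hyperplane `μ^⊥ ⊂ ℝ^d`,
realized as the normalized `(d−2)`-dimensional Hausdorff measure on
`{y : ‖y‖ = 1, μᵀy = 0}`. -/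
noncomputable def subsphereUniform (d : ℕ) (μ : EuclideanSpace ℝ (Fin d)) :
    Measure (EuclideanSpace ℝ (Fin d)) :=
  (μH[(d : ℝ) - 2] (Metric.sphere 0 1 ∩ {y : EuclideanSpace ℝ (Fin d) | ⟪μ, y⟫ = 0}))⁻¹ •
    (μH[(d : ℝ) - 2]).restrict
      (Metric.sphere 0 1 ∩ {y : EuclideanSpace ℝ (Fin d) | ⟪μ, y⟫ = 0})

section aux
variable {d : ℕ} {μ : EuclideanSpace ℝ (Fin d)}

lemma ss_meas : MeasurableSet
    (Metric.sphere 0 1 ∩ {y : EuclideanSpace ℝ (Fin d) | ⟪μ, y⟫ = 0}) := by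
  apply IsClosed.measurableSet
  apply Metric.isClosed_sphere.inter
  exact isClosed_eq (by fun_prop) (by fun_prop)

lemma ss_inv (R : EuclideanSpace ℝ (Fin d) ≃ₗᵢ[ℝ] EuclideanSpace ℝ (Fin d))
    (hR : ∀ y, ⟪μ, R y⟫ = 0 ↔ ⟪μ, y⟫ = 0) :
    MeasurePreserving R (subsphereUniform d μ) (subsphereUniform d μ) := by
  unfold subsphereUniform
  apply MeasurePreserving.smul_measure
  have h := (R.toIsometryEquiv.measurePreserving_hausdorffMeasure ((d : ℝ) - 2)).restrict_preimage
    (ss_meas (μ := μ))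
  have e : R.toIsometryEquiv ⁻¹' (Metric.sphere 0 1 ∩
      {y : EuclideanSpace ℝ (Fin d) | ⟪μ, y⟫ = 0}) =
      (Metric.sphere 0 1 ∩ {y : EuclideanSpace ℝ (Fin d) | ⟪μ, y⟫ = 0}) := by
    ext y
    simp [hR]
  rw [e] at h
  exact h

lemma ss_ae : ∀ᵐ y ∂(subsphereUniform d μ), ‖y‖ = 1 ∧ ⟪μ, y⟫ = 0 := by
  unfold subsphereUniform
  apply Measure.ae_smul_measure
  filter_upwards [ae_restrict_mem (ss_meas (μ := μ))] with y hy
  simpa using hy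

lemma ss_int_inv (R : EuclideanSpace ℝ (Fin d) ≃ₗᵢ[ℝ] EuclideanSpace ℝ (Fin d))
    (hR : ∀ y, ⟪μ, R y⟫ = 0 ↔ ⟪μ, y⟫ = 0) (f : EuclideanSpace ℝ (Fin d) → ℝ) :
    ∫ y, f (R y) ∂(subsphereUniform d μ) = ∫ y, f y ∂(subsphereUniform d μ) :=
  (ss_inv R hR).integral_comp R.toHomeomorph.measurableEmbedding f

lemma ss_mean (u : EuclideanSpace ℝ (Fin d)) : ∫ y, ⟪u, y⟫ ∂(subsphereUniform d μ) = 0 := by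
  have h := ss_int_inv (μ := μ) (LinearIsometryEquiv.neg ℝ) (by simp) (fun y => ⟪u, y⟫)
  simp [integral_neg] at h
  linarith

lemma ss_q_eq {u v : EuclideanSpace ℝ (Fin d)} (hu : ⟪μ, u⟫ = 0) (hv : ⟪μ, v⟫ = 0)
    (h : ‖u‖ = ‖v‖) :
    ∫ y, ⟪u, y⟫ ^ 2 ∂(subsphereUniform d μ) = ∫ y, ⟪v, y⟫ ^ 2 ∂(subsphereUniform d μ) := by
  set R := (ℝ ∙ (u - v))ᗮ.reflection with hRdef
  have hRμ : R μ = μ := by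
    apply Submodule.reflection_mem_subspace_eq_self
    rw [Submodule.mem_orthogonal_singleton_iff_inner_left, inner_sub_right, hu, hv, sub_zero]
  have hRu : R u = v := Submodule.reflection_sub h
  have hR : ∀ y, ⟪μ, R y⟫ = 0 ↔ ⟪μ, y⟫ = 0 := by
    intro y
    conv_lhs => rw [← hRμ, R.inner_map_map]
  rw [← ss_int_inv R hR (fun y => ⟪v, y⟫ ^ 2)]
  congr 1
  ext y
  rw [← hRu, R.inner_map_map]

lemma ss_integrable [IsProbabilityMeasure (subsphereUniform d μ)]
    (u v : EuclideanSpace ℝ (Fin d)) :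
    Integrable (fun y => ⟪u, y⟫ * ⟪v, y⟫) (subsphereUniform d μ) := by
  apply Integrable.of_bound (C := ‖u‖ * ‖v‖)
  · exact Continuous.aestronglyMeasurable (by fun_prop)
  · filter_upwards [ss_ae] with y hy
    rw [norm_mul]
    have h1 := norm_inner_le_norm (𝕜 := ℝ) u y
    have h2 := norm_inner_le_norm (𝕜 := ℝ) v y
    rw [hy.1, mul_one] at h1 h2
    gcongr

lemma ss_q [IsProbabilityMeasure (subsphereUniform d μ)] (hd : 2 ≤ d) (hμ : ‖μ‖ = 1)
    (u : EuclideanSpace ℝ (Fin d)) :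
    ∫ y, ⟪u, y⟫ ^ 2 ∂(subsphereUniform d μ) = (‖u‖ ^ 2 - ⟪μ, u⟫ ^ 2) / ((d : ℝ) - 1) := by
  have hd1 : (0 : ℝ) < (d : ℝ) - 1 := by
    have : (2 : ℝ) ≤ d := by exact_mod_cast hd
    linarith
  have hμμ : ⟪μ, μ⟫ = 1 := by rw [real_inner_self_eq_norm_sq, hμ]; norm_num
  -- projection
  have hP : ∀ u : EuclideanSpace ℝ (Fin d), ⟪μ, u - ⟪μ, u⟫ • μ⟫ = 0 := by
    intro u
    rw [inner_sub_right, inner_smul_right, hμμ]; ring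
  have hPn : ∀ u : EuclideanSpace ℝ (Fin d),
      ‖u - ⟪μ, u⟫ • μ‖ ^ 2 = ‖u‖ ^ 2 - ⟪μ, u⟫ ^ 2 := by
    intro u
    rw [norm_sub_sq_real, norm_smul, inner_smul_right, hμ, real_inner_comm, Real.norm_eq_abs,
      mul_one, sq_abs]
    ring
  have hPq : ∀ u : EuclideanSpace ℝ (Fin d), ∫ y, ⟪u, y⟫ ^ 2 ∂(subsphereUniform d μ) =
      ∫ y, ⟪u - ⟪μ, u⟫ • μ, y⟫ ^ 2 ∂(subsphereUniform d μ) := by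
    intro u
    apply integral_congr_ae
    filter_upwards [ss_ae] with y hy
    rw [inner_sub_left, inner_smul_left, hy.2]
    simp
  -- proportionality
  have hprop : ∀ u v : EuclideanSpace ℝ (Fin d), ⟪μ, u⟫ = 0 → ⟪μ, v⟫ = 0 →
      ‖u‖ ^ 2 * ∫ y, ⟪v, y⟫ ^ 2 ∂(subsphereUniform d μ) =
      ‖v‖ ^ 2 * ∫ y, ⟪u, y⟫ ^ 2 ∂(subsphereUniform d μ) := by
    intro u v hu hv
    have h := ss_q_eq (μ := μ) (u := ‖u‖ • v) (v := ‖v‖ • u) (by simp [inner_smul_right, hv])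
      (by simp [inner_smul_right, hu]) (by simp [norm_smul, mul_comm])
    simpa [inner_smul_left, mul_pow, integral_const_mul] using h
  have hn : ∀ y : EuclideanSpace ℝ (Fin d), ∑ i, ⟪EuclideanSpace.single i (1 : ℝ), y⟫ ^ 2 = ‖y‖ ^ 2 := by
    intro y
    simp [EuclideanSpace.norm_sq_eq, EuclideanSpace.inner_single_left]
  have hsum : ∑ i, ∫ y, ⟪EuclideanSpace.single i (1 : ℝ), y⟫ ^ 2 ∂(subsphereUniform d μ) = 1 := by
    rw [← integral_finsetSum]
    · simp_rw [hn]
      rw [integral_congr_ae (g := fun _ => (1 : ℝ))]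
      · simp
      · filter_upwards [ss_ae] with y hy
        simp [hy.1]
    · intro i _
      simp_rw [pow_two]
      exact ss_integrable _ _
  rw [hPq u, eq_div_iff hd1.ne', ← hPn u]
  set w := u - ⟪μ, u⟫ • μ with hw
  have key : ∀ i : Fin d, ‖w‖ ^ 2 *
      ∫ y, ⟪EuclideanSpace.single i (1 : ℝ), y⟫ ^ 2 ∂(subsphereUniform d μ) =
      (1 - μ i ^ 2) * ∫ y, ⟪w, y⟫ ^ 2 ∂(subsphereUniform d μ) := by
    intro i
    rw [hPq, hprop _ _ (hP u) (hP _), hPn]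
    simp [EuclideanSpace.inner_single_right, hw]
  have hs := Finset.sum_congr (s₁ := (Finset.univ : Finset (Fin d))) rfl (fun i _ => key i)
  rw [← Finset.mul_sum, hsum, ← Finset.sum_mul, Finset.sum_sub_distrib] at hs
  have hm : ∑ i, μ i ^ 2 = 1 := by
    have := EuclideanSpace.norm_sq_eq μ
    simp [hμ] at this
    exact this.symm
  rw [hm] at hs
  simp at hs
  linarith

lemma ss_b [IsProbabilityMeasure (subsphereUniform d μ)] (hd : 2 ≤ d) (hμ : ‖μ‖ = 1)
    (u v : EuclideanSpace ℝ (Fin d)) :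
    ∫ y, ⟪u, y⟫ * ⟪v, y⟫ ∂(subsphereUniform d μ) =
      (⟪u, v⟫ - ⟪μ, u⟫ * ⟪μ, v⟫) / ((d : ℝ) - 1) := by
  have h1 := ss_q (μ := μ) hd hμ (u + v)
  have h2 := ss_q (μ := μ) hd hμ (u - v)
  have h3 : ∫ y, ⟪u, y⟫ * ⟪v, y⟫ ∂(subsphereUniform d μ) =
      ∫ y, (1 / 4 : ℝ) * (⟪u + v, y⟫ ^ 2 - ⟪u - v, y⟫ ^ 2) ∂(subsphereUniform d μ) := by
    congr 1
    ext y
    rw [inner_add_left, inner_sub_left]; ring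
  rw [h3, integral_const_mul, integral_sub, h1, h2, norm_add_sq_real, norm_sub_sq_real,
    inner_add_right, inner_sub_right]
  · ring
  · simp_rw [pow_two]
    exact ss_integrable _ _
  · simp_rw [pow_two]
    exact ss_integrable _ _

end aux

/-- Inversion of the tangent-normal moment relations: with `Eξ² > 1/d`, the second moment
`Eξ²` and the rank-one tensor `μμᵀ` are recovered from `E[XXᵀ]` and
`V = E[Xᵀ E[XXᵀ] X]` via `Eξ² = 1/d + √((d−1)/d)·√(V − 1/d)` and
`μμᵀ = √((d−1)/(dV−1))·(E[XXᵀ] − (1/d)I_d) + (1/d)I_d`. -/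
theorem moment_inversion {Ω : Type*} [MeasurableSpace Ω]
    (ℙ : Measure Ω) [IsProbabilityMeasure ℙ]
    (d : ℕ) (hd : 2 ≤ d) (μ : EuclideanSpace ℝ (Fin d)) (hμ : ‖μ‖ = 1)
    (ξ : Ω → ℝ) (Y : Ω → EuclideanSpace ℝ (Fin d))
    (hξm : Measurable ξ) (hYm : Measurable Y)
    (hξr : ∀ ω, ξ ω ∈ Set.Icc (-1 : ℝ) 1)
    (hindep : ProbabilityTheory.IndepFun ξ Y ℙ)
    (hYdist : Measure.map Y ℙ = subsphereUniform d μ)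
    (X : Ω → EuclideanSpace ℝ (Fin d))
    (hX : ∀ ω, X ω = ξ ω • μ + Real.sqrt (1 - ξ ω ^ 2) • Y ω)
    (hξ2 : 1 / (d : ℝ) < ∫ ω, ξ ω ^ 2 ∂ℙ) :
    (∫ ω, ξ ω ^ 2 ∂ℙ =
        1 / (d : ℝ) + Real.sqrt (((d : ℝ) - 1) / d) *
          Real.sqrt
            ((∫ ω, ∑ i : Fin d, ∑ j : Fin d,
                X ω i * (∫ ω', X ω' i * X ω' j ∂ℙ) * X ω j ∂ℙ) - 1 / d)) ∧
      ∀ i j : Fin d,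
        μ i * μ j =
          Real.sqrt (((d : ℝ) - 1) /
              ((d : ℝ) * (∫ ω, ∑ i' : Fin d, ∑ j' : Fin d,
                  X ω i' * (∫ ω', X ω' i' * X ω' j' ∂ℙ) * X ω j' ∂ℙ) - 1)) *
            ((∫ ω, X ω i * X ω j ∂ℙ) - 1 / (d : ℝ) * (if i = j then (1:ℝ) else 0)) +
          1 / (d : ℝ) * (if i = j then (1:ℝ) else 0) := by
  have hd2 : (2 : ℝ) ≤ d := by exact_mod_cast hd
  have hd1 : (0 : ℝ) < (d : ℝ) - 1 := by linarith
  have hd0 : (0 : ℝ) < (d : ℝ) := by linarith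
  have hprob : IsProbabilityMeasure (subsphereUniform d μ) := by
    rw [← hYdist]; exact Measure.isProbabilityMeasure_map hYm.aemeasurable
  have hYae : ∀ᵐ ω ∂ℙ, ‖Y ω‖ = 1 ∧ ⟪μ, Y ω⟫ = 0 := by
    have h := ss_ae (d := d) (μ := μ)
    rw [← hYdist] at h
    exact ae_of_ae_map hYm.aemeasurable h
  have hcoord : ∀ (y : EuclideanSpace ℝ (Fin d)) (i : Fin d),
      ⟪EuclideanSpace.single i (1 : ℝ), y⟫ = y i := by
    intro y i
    simp [EuclideanSpace.inner_single_left]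
  have hE : ∀ g : EuclideanSpace ℝ (Fin d) → ℝ, Continuous g →
      ∫ ω, g (Y ω) ∂ℙ = ∫ y, g y ∂(subsphereUniform d μ) := by
    intro g hg
    rw [← hYdist, integral_map hYm.aemeasurable hg.aestronglyMeasurable]
  have hY1 : ∀ i : Fin d, ∫ ω, Y ω i ∂ℙ = 0 := by
    intro i
    rw [hE (fun y => y i) (by fun_prop), ← ss_mean (μ := μ) (EuclideanSpace.single i (1 : ℝ))]
    simp_rw [hcoord]
  have hY2 : ∀ i j : Fin d, ∫ ω, Y ω i * Y ω j ∂ℙ =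
      ((if i = j then (1 : ℝ) else 0) - μ i * μ j) / ((d : ℝ) - 1) := by
    intro i j
    have h := ss_b (μ := μ) hd hμ (EuclideanSpace.single i (1 : ℝ)) (EuclideanSpace.single j (1 : ℝ))
    rw [hE (fun y => y i * y j) (by fun_prop)]
    simp_rw [real_inner_comm _ μ, hcoord] at h
    rw [h]
    simp
  have hYb : ∀ i : Fin d, ∀ᵐ ω ∂ℙ, ‖Y ω i‖ ≤ 1 := by
    intro i
    filter_upwards [hYae] with ω hω
    rw [← hω.1]
    exact PiLp.norm_apply_le (Y ω) i
  have hYim : ∀ i : Fin d, Measurable (fun ω => Y ω i) := fun i => by fun_prop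
  have hsq : ∀ ω, 0 ≤ 1 - ξ ω ^ 2 := by
    intro ω
    nlinarith [(hξr ω).1, (hξr ω).2]
  -- products of a bounded function of ξ and a bounded function of Y
  have hint : ∀ (f : ℝ → ℝ) (g : EuclideanSpace ℝ (Fin d) → ℝ), Continuous f → Continuous g →
      (∀ ω, ‖f (ξ ω)‖ ≤ 1) → (∀ᵐ ω ∂ℙ, ‖g (Y ω)‖ ≤ 1) →
      Integrable (fun ω => f (ξ ω) * g (Y ω)) ℙ := by
    intro f g hf hg hfb hgb
    apply Integrable.of_bound (C := 1)
    · exact ((hf.measurable.comp hξm).mul (hg.measurable.comp hYm)).aestronglyMeasurable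
    · filter_upwards [hgb] with ω hω
      rw [norm_mul]
      exact mul_le_one₀ (hfb ω) (norm_nonneg _) hω
  have hprod : ∀ (f : ℝ → ℝ) (g : EuclideanSpace ℝ (Fin d) → ℝ), Continuous f → Continuous g →
      ∫ ω, f (ξ ω) * g (Y ω) ∂ℙ = (∫ ω, f (ξ ω) ∂ℙ) * ∫ ω, g (Y ω) ∂ℙ := by
    intro f g hf hg
    exact (hindep.comp hf.measurable hg.measurable).integral_fun_mul_eq_mul_integral
      (hf.measurable.comp hξm).aestronglyMeasurable (hg.measurable.comp hYm).aestronglyMeasurable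
  set a := ∫ ω, ξ ω ^ 2 ∂ℙ with ha
  have hb1 : ∀ ω, ‖ξ ω ^ 2‖ ≤ 1 := by
    intro ω
    rw [Real.norm_eq_abs, abs_of_nonneg (sq_nonneg _)]
    linarith [hsq ω]
  have hb2 : ∀ ω, ‖1 - ξ ω ^ 2‖ ≤ 1 := by
    intro ω
    rw [Real.norm_eq_abs, abs_of_nonneg (hsq ω)]
    linarith [sq_nonneg (ξ ω)]
  have hb3 : ∀ ω, ‖ξ ω * Real.sqrt (1 - ξ ω ^ 2)‖ ≤ 1 := by
    intro ω
    rw [norm_mul]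
    apply mul_le_one₀ _ (norm_nonneg _)
    · rw [Real.norm_eq_abs, abs_of_nonneg (Real.sqrt_nonneg _)]
      apply Real.sqrt_le_one.mpr
      linarith [sq_nonneg (ξ ω)]
    · exact abs_le.mpr (hξr ω)
  have hi0 : Integrable (fun ω => ξ ω ^ 2) ℙ := by
    have := hint (fun t => t ^ 2) (fun _ => 1) (by fun_prop) (by fun_prop) hb1 (by simp)
    simpa using this
  have hYYb : ∀ i j : Fin d, ∀ᵐ ω ∂ℙ, ‖Y ω i * Y ω j‖ ≤ 1 := by
    intro i j
    filter_upwards [hYb i, hYb j] with ω h1 h2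
    rw [norm_mul]
    exact mul_le_one₀ h1 (norm_nonneg _) h2
  have hXX : ∀ i j : Fin d, (fun ω => X ω i * X ω j) = fun ω =>
      (μ i * μ j) * ξ ω ^ 2 + (μ i * ((ξ ω * Real.sqrt (1 - ξ ω ^ 2)) * Y ω j) +
        (μ j * ((ξ ω * Real.sqrt (1 - ξ ω ^ 2)) * Y ω i) + (1 - ξ ω ^ 2) * (Y ω i * Y ω j))) := by
    intro i j
    ext ω
    have h := Real.mul_self_sqrt (hsq ω)
    simp only [hX ω, PiLp.add_apply, PiLp.smul_apply, smul_eq_mul]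
    linear_combination (Y ω i * Y ω j) * h
  have hI1 : ∀ i j : Fin d, Integrable (fun ω => (μ i * μ j) * ξ ω ^ 2) ℙ :=
    fun i j => hi0.const_mul _
  have hI2 : ∀ i j : Fin d,
      Integrable (fun ω => μ i * ((ξ ω * Real.sqrt (1 - ξ ω ^ 2)) * Y ω j)) ℙ :=
    fun i j => (hint (fun t => t * Real.sqrt (1 - t ^ 2)) (fun y => y j) (by fun_prop)
      (by fun_prop) hb3 (hYb j)).const_mul _
  have hI3 : ∀ i j : Fin d, Integrable (fun ω => (1 - ξ ω ^ 2) * (Y ω i * Y ω j)) ℙ :=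
    fun i j => hint (fun t => 1 - t ^ 2) (fun y => y i * y j) (by fun_prop)
      (by fun_prop) hb2 (hYYb i j)
  have hXi : ∀ i j : Fin d, Integrable (fun ω => X ω i * X ω j) ℙ := by
    intro i j
    rw [hXX]
    exact (hI1 i j).add ((hI2 i j).add ((hI2 j i).add (hI3 i j)))
  have hM : ∀ i j : Fin d, ∫ ω, X ω i * X ω j ∂ℙ = a * (μ i * μ j) +
      (1 - a) / ((d : ℝ) - 1) * ((if i = j then (1 : ℝ) else 0) - μ i * μ j) := by
    intro i j
    have e1 := fun k : Fin d => hprod (fun t => t * Real.sqrt (1 - t ^ 2)) (fun y => y k)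
      (by fun_prop) (by fun_prop)
    have e2 := hprod (fun t => 1 - t ^ 2) (fun y => y i * y j) (by fun_prop) (by fun_prop)
    simp only [hY1, mul_zero] at e1
    simp only [hY2] at e2
    rw [integral_sub (integrable_const _) hi0, ← ha] at e2
    have hJ1 : Integrable (fun ω => μ j * ((ξ ω * Real.sqrt (1 - ξ ω ^ 2)) * Y ω i) +
        (1 - ξ ω ^ 2) * (Y ω i * Y ω j)) ℙ := (hI2 j i).add (hI3 i j)
    have hJ2 : Integrable (fun ω => μ i * ((ξ ω * Real.sqrt (1 - ξ ω ^ 2)) * Y ω j) +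
        (μ j * ((ξ ω * Real.sqrt (1 - ξ ω ^ 2)) * Y ω i) +
        (1 - ξ ω ^ 2) * (Y ω i * Y ω j))) ℙ := (hI2 i j).add hJ1
    rw [hXX, integral_add (hI1 i j) hJ2,
      integral_add (hI2 i j) hJ1, integral_add (hI2 j i) (hI3 i j),
      integral_const_mul, integral_const_mul, integral_const_mul, e1, e1, e2, ← ha]
    simp only [integral_const, probReal_univ, smul_eq_mul]
    ring
  have hm : ∑ i, μ i ^ 2 = 1 := by
    have := EuclideanSpace.norm_sq_eq μ
    simp [hμ] at this
    exact this.symm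
  set b := (1 - a) / ((d : ℝ) - 1) with hb
  have hV : ∫ ω, ∑ i : Fin d, ∑ j : Fin d,
      X ω i * (∫ ω', X ω' i * X ω' j ∂ℙ) * X ω j ∂ℙ = a ^ 2 + ((d : ℝ) - 1) * b ^ 2 := by
    have e : ∀ i j : Fin d, (fun ω => X ω i * (∫ ω', X ω' i * X ω' j ∂ℙ) * X ω j) =
        fun ω => (∫ ω', X ω' i * X ω' j ∂ℙ) * (X ω i * X ω j) := by
      intro i j; ext ω; ring
    have hei : ∀ i j : Fin d,
        Integrable (fun ω => X ω i * (∫ ω', X ω' i * X ω' j ∂ℙ) * X ω j) ℙ := by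
      intro i j; rw [e]; exact (hXi i j).const_mul _
    rw [integral_finsetSum _ (fun i _ => integrable_finsetSum _ (fun j _ => hei i j))]
    have e3 : ∀ i : Fin d, ∫ ω, ∑ j : Fin d,
        X ω i * (∫ ω', X ω' i * X ω' j ∂ℙ) * X ω j ∂ℙ =
        (a - b) ^ 2 * μ i ^ 2 + (2 * (a - b) * b * μ i ^ 2 + b ^ 2) := by
      intro i
      rw [integral_finsetSum _ (fun j _ => hei i j)]
      have e4 : ∀ j : Fin d, ∫ ω, X ω i * (∫ ω', X ω' i * X ω' j ∂ℙ) * X ω j ∂ℙ =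
          ((a - b) ^ 2 * μ i ^ 2) * μ j ^ 2 +
            (if i = j then 2 * (a - b) * b * μ i * μ j + b ^ 2 else 0) := by
        intro j
        rw [e, integral_const_mul, hM]
        split_ifs <;> ring
      rw [Finset.sum_congr rfl (fun j _ => e4 j), Finset.sum_add_distrib, ← Finset.mul_sum, hm,
        Finset.sum_ite_eq]
      simp
      ring
    rw [Finset.sum_congr rfl (fun i _ => e3 i), Finset.sum_add_distrib, Finset.sum_add_distrib,
      ← Finset.mul_sum, ← Finset.mul_sum, hm]
    simp
    ring
  rw [hV]
  have hda : 0 < (d : ℝ) * a - 1 := by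
    rw [div_lt_iff₀ hd0] at hξ2
    linarith
  have hne1 := hd1.ne'
  have hne0 := hd0.ne'
  have hnea := hda.ne'
  constructor
  · rw [← Real.sqrt_mul (by positivity)]
    have : ((d : ℝ) - 1) / d * (a ^ 2 + ((d : ℝ) - 1) * b ^ 2 - 1 / d) =
        (((d : ℝ) * a - 1) / d) ^ 2 := by
      rw [hb]; field_simp; ring
    rw [this, Real.sqrt_sq (by positivity)]
    field_simp
    ring
  · intro i j
    have h1 : (d : ℝ) * (a ^ 2 + ((d : ℝ) - 1) * b ^ 2) - 1 =
        ((d : ℝ) * a - 1) ^ 2 / ((d : ℝ) - 1) := by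
      rw [hb]; field_simp; ring
    have h2 : ((d : ℝ) - 1) / ((d : ℝ) * (a ^ 2 + ((d : ℝ) - 1) * b ^ 2) - 1) =
        (((d : ℝ) - 1) / ((d : ℝ) * a - 1)) ^ 2 := by
      rw [h1]; field_simp
    rw [h2, Real.sqrt_sq (by positivity), hM]
    generalize (if i = j then (1 : ℝ) else 0) = δ
    field_simp
    ring
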